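/- arXiv:2111.03732 — 2 statements merged into one kernel-verified Lean document; each statement's English description precedes it below -/
import Mathlib

section
/- Let 0 ≤ α < n. There exists a positive constant c, depending only on n and α, such that for every non-negative non-increasing measurable function φ on (0,∞) there exists a measurable function f on ℝⁿ with f* = φ almost everywhere on (0,∞) and (M_α f)*(t) ≥ c · sup_{t < τ < ∞} τ^{α/n} f**(τ) for all t > 0. -/
open MeasureTheory ENNReal Set Metric

/-- Non-increasing rearrangement of an `ℝ≥0∞`-valued function on `ℝⁿ`:
`g*(t) = inf {l | volume {x | g x > l} ≤ t}`. -/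
noncomputable def rearr (n : ℕ) (g : EuclideanSpace ℝ (Fin n) → ℝ≥0∞) (t : ℝ) : ℝ≥0∞ :=
  sInf {l : ℝ≥0∞ | volume {x | l < g x} ≤ ENNReal.ofReal t}

/-- The fractional maximal operator
`M_α f (x) = sup_{r>0} |B(x,r)|^(α/n - 1) ∫_{B(x,r)} |f|`. -/
noncomputable def fracMax (n : ℕ) (α : ℝ) (f : EuclideanSpace ℝ (Fin n) → ℝ)
    (x : EuclideanSpace ℝ (Fin n)) : ℝ≥0∞ :=
  ⨆ r : {r : ℝ // 0 < r},
    volume (ball x r.1) ^ (α / n - 1 : ℝ) * ∫⁻ y in ball x r.1, ENNReal.ofReal |f y|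

/-- `f**(t) = (1/t) ∫₀^t f*(s) ds` for a real-valued `f` on `ℝⁿ`. -/
noncomputable def dstar (n : ℕ) (f : EuclideanSpace ℝ (Fin n) → ℝ) (t : ℝ) : ℝ≥0∞ :=
  ENNReal.ofReal (1 / t) *
    ∫⁻ s in Set.Ioc (0 : ℝ) t, rearr n (fun y => ENNReal.ofReal |f y|) s

/-- Lorentz norm `‖g‖_{L_{p,q}} = (∫₀^∞ (t^{1/p} g*(t))^q dt/t)^{1/q}`, with the usual
supremum modification when `q = ∞`. -/
noncomputable def lorentzNorm (n : ℕ) (p : ℝ) (q : ℝ≥0∞)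
    (g : EuclideanSpace ℝ (Fin n) → ℝ≥0∞) : ℝ≥0∞ :=
  if q = ⊤ then
    ⨆ t : {t : ℝ // 0 < t}, ENNReal.ofReal (t.1 ^ (1 / p)) * rearr n g t.1
  else
    (∫⁻ t in Set.Ioi (0 : ℝ),
        (ENNReal.ofReal (t ^ (1 / p)) * rearr n g t) ^ q.toReal * ENNReal.ofReal (1 / t)) ^
      (1 / q.toReal)

/-- Lorentz–Morrey norm
`‖g‖_{𝓛_{p,q;λ}} = sup_{x, r>0} r^{-λ/p} ‖g χ_{B(x,r)}‖_{L_{p,q}}`. -/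
noncomputable def lorentzMorrey (n : ℕ) (p : ℝ) (q : ℝ≥0∞) (lam : ℝ)
    (g : EuclideanSpace ℝ (Fin n) → ℝ≥0∞) : ℝ≥0∞ :=
  ⨆ (x : EuclideanSpace ℝ (Fin n)) (r : {r : ℝ // 0 < r}),
    ENNReal.ofReal (r.1 ^ (-(lam / p))) * lorentzNorm n p q ((ball x r.1).indicator g)

noncomputable def vfun (n : ℕ) (x : EuclideanSpace ℝ (Fin n)) : ℝ :=
  (volume (ball (0 : EuclideanSpace ℝ (Fin n)) 1)).toReal * ‖x‖ ^ n

lemma omega_pos (n : ℕ) : 0 < (volume (ball (0 : EuclideanSpace ℝ (Fin n)) 1)).toReal :=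
  ENNReal.toReal_pos (measure_ball_pos _ _ one_pos).ne' measure_ball_lt_top.ne

lemma vol_ball_eq (n : ℕ) (x : EuclideanSpace ℝ (Fin n)) {r : ℝ} (hr : 0 < r) :
    volume (ball x r) =
      ENNReal.ofReal ((volume (ball (0 : EuclideanSpace ℝ (Fin n)) 1)).toReal * r ^ n) := by
  rw [Measure.addHaar_ball_of_pos _ _ hr, finrank_euclideanSpace_fin, mul_comm,
    ENNReal.ofReal_mul ENNReal.toReal_nonneg, ENNReal.ofReal_toReal measure_ball_lt_top.ne]

lemma vfun_meas (n : ℕ) : Measurable (vfun n) := by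
  unfold vfun; fun_prop

lemma exists_rad (n : ℕ) (hn : n ≠ 0) {s : ℝ} (hs : 0 ≤ s) :
    ∃ R : ℝ, 0 ≤ R ∧ (volume (ball (0 : EuclideanSpace ℝ (Fin n)) 1)).toReal * R ^ n = s := by
  have h := omega_pos n
  refine ⟨(s / (volume (ball (0 : EuclideanSpace ℝ (Fin n)) 1)).toReal) ^ ((n : ℝ)⁻¹),
    by positivity, ?_⟩
  rw [Real.rpow_inv_natCast_pow (by positivity) hn]
  field_simp

lemma vol_vfun_le (n : ℕ) (hn : n ≠ 0) (s : ℝ) :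
    volume {x | vfun n x ≤ s} = ENNReal.ofReal s := by
  have h := omega_pos n
  rcases lt_or_ge s 0 with hs | hs
  · rw [ENNReal.ofReal_of_nonpos hs.le]
    convert measure_empty (μ := (volume : Measure (EuclideanSpace ℝ (Fin n))))
    ext x
    simp only [mem_ofPred_eq, mem_empty_iff_false, iff_false, not_le]
    exact hs.trans_le (by unfold vfun; positivity)
  · obtain ⟨R, hR, rfl⟩ := exists_rad n hn hs
    have : {x | vfun n x ≤ (volume (ball (0 : EuclideanSpace ℝ (Fin n)) 1)).toReal * R ^ n}
        = closedBall 0 R := by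
      ext x
      simp only [vfun, mem_ofPred_eq, mem_closedBall, dist_zero_right]
      rw [mul_le_mul_iff_right₀ h, pow_le_pow_iff_left₀ (norm_nonneg _) hR hn]
    rw [this, Measure.addHaar_closedBall _ _ hR, finrank_euclideanSpace_fin, mul_comm,
      ENNReal.ofReal_mul ENNReal.toReal_nonneg, ENNReal.ofReal_toReal measure_ball_lt_top.ne]

lemma map_vfun (n : ℕ) (hn : n ≠ 0) :
    (volume : Measure (EuclideanSpace ℝ (Fin n))).map (vfun n) = volume.restrict (Ioi 0) := by
  symm
  refine Measure.ext_of_Ioc _ _ fun a b hab => ?_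
  rw [Measure.map_apply (vfun_meas n) measurableSet_Ioc, Measure.restrict_apply measurableSet_Ioc,
    Ioc_inter_Ioi, Real.volume_Ioc]
  have : vfun n ⁻¹' Ioc a b = {x | vfun n x ≤ b} \ {x | vfun n x ≤ a} := by
    ext x; simp [and_comm]
  have hss : {x | vfun n x ≤ a} ⊆ {x | vfun n x ≤ b} := by
    intro x hx
    simp only [mem_ofPred_eq] at hx ⊢
    exact hx.trans hab.le
  rw [this, measure_sdiff hss
    (measurableSet_le (vfun_meas n) measurable_const).nullMeasurableSet
    (by rw [vol_vfun_le n hn]; exact ENNReal.ofReal_ne_top), vol_vfun_le n hn, vol_vfun_le n hn]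
  rcases le_total a 0 with ha | ha
  · simp [ha, ENNReal.ofReal_of_nonpos ha]
  · rw [← ENNReal.ofReal_sub _ ha, max_eq_left ha]

lemma rearr_ae (n : ℕ) (hn : n ≠ 0) (φ : ℝ → ℝ) (hm : Measurable φ) (h0 : ∀ t, 0 ≤ φ t)
    (ha : AntitoneOn φ (Ioi 0)) :
    ∀ᵐ t ∂(volume.restrict (Set.Ioi (0 : ℝ))),
      rearr n (fun y => ENNReal.ofReal |φ (vfun n y)|) t = ENNReal.ofReal (φ t) := by
  have hc := ha.countable_not_continuousWithinAt
  have hae := (hc.ae_notMem (volume.restrict (Set.Ioi (0 : ℝ))))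
  filter_upwards [hae, ae_restrict_mem measurableSet_Ioi] with t ht ht0
  have ht0' : 0 < t := ht0
  have hcont : ContinuousWithinAt φ (Ioi 0) t := by
    by_contra hcon; exact ht ⟨ht0, hcon⟩
  have hcont : ContinuousAt φ t := hcont.continuousAt (Ioi_mem_nhds ht0)
  have key : ∀ l : ℝ≥0∞, volume {x | l < ENNReal.ofReal |φ (vfun n x)|} =
      volume ({s | l < ENNReal.ofReal (φ s)} ∩ Ioi 0) := by
    intro l
    have hms : MeasurableSet {s | l < ENNReal.ofReal (φ s)} :=
      measurableSet_lt measurable_const hm.ennreal_ofReal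
    rw [← Measure.restrict_apply hms, ← map_vfun n hn, Measure.map_apply (vfun_meas n) hms]
    simp only [abs_of_nonneg (h0 _)]; rfl
  apply le_antisymm
  · apply sInf_le
    simp only [mem_ofPred_eq]
    rw [key]
    calc _ ≤ volume (Ioc 0 t) := by
          apply measure_mono
          rintro s ⟨hs, hs0⟩
          refine ⟨hs0, ?_⟩
          by_contra! hlt
          exact absurd (ENNReal.ofReal_le_ofReal (ha ht0 hs0 hlt.le)) (not_le.2 hs)
      _ = _ := by simp
  · apply le_sInf
    intro l hl
    simp only [mem_ofPred_eq] at hl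
    rw [key] at hl
    by_contra! hlt
    have hc2 : ContinuousAt (fun s => ENNReal.ofReal (φ s)) t :=
      ENNReal.continuous_ofReal.continuousAt.comp hcont
    have hev := (hc2.eventually (lt_mem_nhds hlt))
    obtain ⟨ε, hε, hb⟩ := Metric.eventually_nhds_iff.1 hev
    have hsub : Ioc 0 (t + ε / 2) ⊆ {s | l < ENNReal.ofReal (φ s)} ∩ Ioi 0 := by
      rintro s ⟨hs0, hs⟩
      refine ⟨?_, hs0⟩
      have h1 : l < ENNReal.ofReal (φ (t + ε / 2)) := hb (by
        rw [Real.dist_eq, add_sub_cancel_left, abs_of_pos (by positivity)]; linarith)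
      exact h1.trans_le (ENNReal.ofReal_le_ofReal (ha hs0 (by simp; positivity) hs))
    have := (measure_mono hsub).trans hl
    rw [Real.volume_Ioc, ENNReal.ofReal_le_ofReal_iff ht0'.le] at this
    linarith

/-- for `0 ≤ α < n` there is `c > 0` (depending only on `n, α`) such that
for every non-negative non-increasing measurable `φ` on `(0,∞)` there exists `f` on `ℝⁿ`
with `f* = φ` a.e. on `(0,∞)` and `(M_α f)*(t) ≥ c · sup_{t<τ<∞} τ^{α/n} f**(τ)` for all `t > 0`. -/
theorem stmt_4 (n : ℕ) (α : ℝ) (hα0 : 0 ≤ α) (hαn : α < n) :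
    ∃ c : ℝ, 0 < c ∧
      ∀ φ : ℝ → ℝ, Measurable φ → (∀ t, 0 ≤ φ t) → AntitoneOn φ (Set.Ioi 0) →
        ∃ f : EuclideanSpace ℝ (Fin n) → ℝ, Measurable f ∧
          (∀ᵐ t ∂(volume.restrict (Set.Ioi (0 : ℝ))),
            rearr n (fun y => ENNReal.ofReal |f y|) t = ENNReal.ofReal (φ t)) ∧
          ∀ t : ℝ, 0 < t →
            ENNReal.ofReal c *
                (⨆ τ : {τ : ℝ // t < τ}, ENNReal.ofReal (τ.1 ^ (α / n)) * dstar n f τ.1) ≤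
              rearr n (fracMax n α f) t := by
  have hn : n ≠ 0 := by
    rintro rfl
    simp at hαn; linarith
  refine ⟨((2 : ℝ) ^ n) ^ (α / n - 1), by positivity, fun φ hm h0 ha => ?_⟩
  have hae := rearr_ae n hn φ hm h0 ha
  refine ⟨fun x => φ (vfun n x), hm.comp (vfun_meas n), hae, fun t ht => ?_⟩
  rw [ENNReal.mul_iSup]
  refine iSup_le fun ⟨τ, hτ⟩ => ?_
  have hτ0 : 0 < τ := ht.trans hτ
  have hω := omega_pos n
  obtain ⟨R, hR, hRτ⟩ := exists_rad n hn hτ0.le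
  have hR0 : 0 < R := by
    rcases hR.eq_or_lt with h | h
    · rw [← h, zero_pow hn] at hRτ; simp at hRτ; linarith
    · exact h
  have hint : ∫⁻ s in Set.Ioc (0 : ℝ) τ,
      rearr n (fun y => ENNReal.ofReal |φ (vfun n y)|) s =
      ∫⁻ y in {x | vfun n x ≤ τ}, ENNReal.ofReal |φ (vfun n y)| := by
    have h1 : ∫⁻ s in Set.Ioc (0 : ℝ) τ,
        rearr n (fun y => ENNReal.ofReal |φ (vfun n y)|) s =
        ∫⁻ s in Set.Ioc (0 : ℝ) τ, ENNReal.ofReal |φ s| := by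
      apply lintegral_congr_ae
      filter_upwards [ae_restrict_of_ae_restrict_of_subset Ioc_subset_Ioi_self hae] with s hs
      rw [hs, abs_of_nonneg (h0 _)]
    have h2 : Ioc 0 τ = Iic τ ∩ Ioi 0 := by ext; simp [and_comm]
    have hmm : Measurable fun s => ENNReal.ofReal |φ s| := by fun_prop
    rw [h1, h2, ← Measure.restrict_restrict measurableSet_Iic, ← map_vfun n hn,
      setLIntegral_map measurableSet_Iic hmm (vfun_meas n)]
    rfl
  have hvτ : ∀ x, vfun n x ≤ τ → ‖x‖ ≤ R := by
    intro x hx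
    rw [← hRτ, vfun, mul_le_mul_iff_right₀ hω, pow_le_pow_iff_left₀ (norm_nonneg _) hR hn] at hx
    exact hx
  -- closed balls, so use the strict inequality for the centre
  have hlow : ∀ x, vfun n x < τ → ENNReal.ofReal (((2 : ℝ) ^ n) ^ (α / n - 1)) *
      (ENNReal.ofReal (τ ^ (α / n)) * dstar n (fun x => φ (vfun n x)) τ) ≤
      fracMax n α (fun x => φ (vfun n x)) x := by
    intro x hx
    have hxR : ‖x‖ < R := by
      rw [← hRτ, vfun, mul_lt_mul_iff_right₀ hω, pow_lt_pow_iff_left₀ (norm_nonneg _) hR hn] at hx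
      exact hx
    refine le_trans ?_ (le_iSup _ (⟨2 * R, by positivity⟩ : {r : ℝ // 0 < r}))
    rw [dstar, hint, ← mul_assoc, ← mul_assoc]
    refine mul_le_mul' (le_of_eq ?_) (lintegral_mono_set ?_)
    · rw [vol_ball_eq n x (by positivity), mul_pow, mul_left_comm, hRτ,
        ENNReal.ofReal_rpow_of_pos (by positivity), ← ENNReal.ofReal_mul (by positivity),
        ← ENNReal.ofReal_mul (by positivity), Real.mul_rpow (by positivity) hτ0.le,
        Real.rpow_sub_one hτ0.ne' (α / n)]
      congr 1; ring
    · intro y hy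
      have := hvτ y hy
      rw [mem_ball, dist_eq_norm]
      calc ‖y - x‖ ≤ ‖y‖ + ‖x‖ := norm_sub_le _ _
        _ < 2 * R := by linarith
  refine le_sInf fun l hl => ?_
  by_contra! hlt
  have hsub : {x | vfun n x ≤ (t + τ) / 2} ⊆
      {x | l < fracMax n α (fun x => φ (vfun n x)) x} := by
    intro x hx
    have hx : vfun n x ≤ (t + τ) / 2 := hx
    exact hlt.trans_le (hlow x (by linarith))
  have := (measure_mono hsub).trans hl
  rw [vol_vfun_le n hn, ENNReal.ofReal_le_ofReal_iff ht.le] at this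
  linarith
end

section
/- Let 1 < p < ∞, 1 ≤ q < ∞ and 0 ≤ λ ≤ n. Then the Hardy–Littlewood maximal operator M is bounded on the Lorentz–Morrey space 𝓛_{p,q;λ}(ℝⁿ): there exists a constant C > 0 such that ‖Mf‖_{𝓛_{p,q;λ}(ℝⁿ)} ≤ C ‖f‖_{𝓛_{p,q;λ}(ℝⁿ)} for all f ∈ 𝓛_{p,q;λ}(ℝⁿ). -/
open MeasureTheory ENNReal Set Metric

lemma rearr_mono' (n : ℕ) {g g' : EuclideanSpace ℝ (Fin n) → ℝ≥0∞} (h : ∀ x, g x ≤ g' x) (t : ℝ) :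
    rearr n g t ≤ rearr n g' t := by
  apply sInf_le_sInf
  intro l hl
  exact (measure_mono (fun x hx => lt_of_lt_of_le hx (h x))).trans hl

lemma rearr_anti (n : ℕ) (g : EuclideanSpace ℝ (Fin n) → ℝ≥0∞) : Antitone (rearr n g) := by
  intro s t hst
  apply sInf_le_sInf
  intro l hl
  exact le_trans hl (ENNReal.ofReal_le_ofReal hst)

lemma measurable_rearr (n : ℕ) (g : EuclideanSpace ℝ (Fin n) → ℝ≥0∞) : Measurable (rearr n g) :=
  (rearr_anti n g).measurable

lemma vol_le_of_rearr_lt (n : ℕ) (g : EuclideanSpace ℝ (Fin n) → ℝ≥0∞) {t : ℝ} {c : ℝ≥0∞}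
    (h : rearr n g t < c) : volume {x | c < g x} ≤ ENNReal.ofReal t := by
  obtain ⟨l, hl, hlc⟩ := sInf_lt_iff.1 h
  exact (measure_mono (fun x hx => lt_trans hlc hx)).trans hl

lemma vol_lt (a : ℝ≥0∞) : volume {l : ℝ | 0 < l ∧ ENNReal.ofReal l < a} = a := by
  rcases eq_or_ne a ⊤ with rfl | ha
  · have : {l : ℝ | 0 < l ∧ ENNReal.ofReal l < ⊤} = Ioi 0 := by ext; simp
    rw [this]; simp
  · have : {l : ℝ | 0 < l ∧ ENNReal.ofReal l < a} = Ioo 0 a.toReal := by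
      ext l
      simp only [mem_ofPred_eq, mem_Ioo]
      refine and_congr_right fun hl => ?_
      rw [ENNReal.ofReal_lt_iff_lt_toReal hl.le ha]
    rw [this]; simp [ha]

lemma vol_le (a : ℝ≥0∞) : volume {l : ℝ | 0 < l ∧ ENNReal.ofReal l ≤ a} = a := by
  rcases eq_or_ne a ⊤ with rfl | ha
  · have : {l : ℝ | 0 < l ∧ ENNReal.ofReal l ≤ ⊤} = Ioi 0 := by ext; simp
    rw [this]; simp
  · have : {l : ℝ | 0 < l ∧ ENNReal.ofReal l ≤ a} = Ioc 0 a.toReal := by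
      ext l
      simp only [mem_ofPred_eq, mem_Ioc]
      refine and_congr_right fun hl => ?_
      rw [ENNReal.ofReal_le_iff_le_toReal ha]
    rw [this]; simp [ha]

lemma layer_lt {α : Type*} [MeasurableSpace α] (μ : Measure α) [SFinite μ] {g : α → ℝ≥0∞}
    (hg : Measurable g) :
    ∫⁻ x, g x ∂μ = ∫⁻ l : ℝ, μ {x | 0 < l ∧ ENNReal.ofReal l < g x} := by
  have hS : MeasurableSet {z : α × ℝ | 0 < z.2 ∧ ENNReal.ofReal z.2 < g z.1} := by
    apply MeasurableSet.inter
    · exact measurableSet_lt measurable_const measurable_snd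
    · exact measurableSet_lt (ENNReal.measurable_ofReal.comp measurable_snd) (hg.comp measurable_fst)
  have h1 := Measure.prod_apply (μ := μ) (ν := (volume : Measure ℝ)) hS
  have h2 := Measure.prod_apply_symm (μ := μ) (ν := (volume : Measure ℝ)) hS
  rw [h1] at h2
  refine Eq.trans ?_ h2
  refine lintegral_congr fun x => ?_
  exact (vol_lt (g x)).symm

lemma layer_le {α : Type*} [MeasurableSpace α] (μ : Measure α) [SFinite μ] {g : α → ℝ≥0∞}
    (hg : Measurable g) :
    ∫⁻ x, g x ∂μ = ∫⁻ l : ℝ, μ {x | 0 < l ∧ ENNReal.ofReal l ≤ g x} := by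
  have hS : MeasurableSet {z : α × ℝ | 0 < z.2 ∧ ENNReal.ofReal z.2 ≤ g z.1} := by
    apply MeasurableSet.inter
    · exact measurableSet_lt measurable_const measurable_snd
    · exact measurableSet_le (ENNReal.measurable_ofReal.comp measurable_snd) (hg.comp measurable_fst)
  have h1 := Measure.prod_apply (μ := μ) (ν := (volume : Measure ℝ)) hS
  have h2 := Measure.prod_apply_symm (μ := μ) (ν := (volume : Measure ℝ)) hS
  rw [h1] at h2
  refine Eq.trans ?_ h2
  refine lintegral_congr fun x => ?_
  exact (vol_le (g x)).symm

lemma setL_le_rearr (n : ℕ) {G : EuclideanSpace ℝ (Fin n) → ℝ≥0∞} (hG : Measurable G)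
    {E : Set (EuclideanSpace ℝ (Fin n))} {t : ℝ}
    (hE : volume E ≤ ENNReal.ofReal t) :
    ∫⁻ x in E, G x ≤ ∫⁻ s in Ioc (0:ℝ) t, rearr n G s := by
  rw [layer_lt _ hG, layer_le _ (measurable_rearr n G)]
  refine lintegral_mono fun l => ?_
  by_cases hl : 0 < l
  swap
  · simp [hl]
  have hm1 : MeasurableSet {x | 0 < l ∧ ENNReal.ofReal l < G x} := by
    simp only [hl, true_and]; exact measurableSet_lt measurable_const hG
  have hm2 : MeasurableSet {x | 0 < l ∧ ENNReal.ofReal l ≤ rearr n G x} := by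
    simp only [hl, true_and]; exact measurableSet_le measurable_const (measurable_rearr n G)
  simp only [Measure.restrict_apply hm1, Measure.restrict_apply hm2]
  simp only [hl, true_and]
  set D := volume {x | ENNReal.ofReal l < G x} with hD
  have h1 : volume ({x | ENNReal.ofReal l < G x} ∩ E) ≤ min D (ENNReal.ofReal t) :=
    le_min (measure_mono inter_subset_left) ((measure_mono inter_subset_right).trans hE)
  refine h1.trans ?_
  have hfin : min D (ENNReal.ofReal t) ≠ ⊤ := ne_top_of_le_ne_top ENNReal.ofReal_ne_top (min_le_right _ _)
  have h2 : Ioo 0 (min D (ENNReal.ofReal t)).toReal ⊆ {x | ENNReal.ofReal l ≤ rearr n G x} ∩ Ioc 0 t := by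
    rintro s ⟨hs0, hs⟩
    have hs' := (ENNReal.ofReal_lt_iff_lt_toReal hs0.le hfin).2 hs
    have hst : s < t := by
      have := hs'.trans_le (min_le_right _ _)
      exact (ENNReal.ofReal_lt_ofReal_iff_of_nonneg hs0.le).1 this
    refine ⟨?_, hs0, hst.le⟩
    by_contra hcon
    simp only [mem_ofPred_eq, not_le] at hcon
    exact absurd (vol_le_of_rearr_lt n G hcon) (not_le.2 (hs'.trans_le (min_le_left _ _)))
  calc min D (ENNReal.ofReal t) = volume (Ioo 0 (min D (ENNReal.ofReal t)).toReal) := by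
        simp [ENNReal.ofReal_toReal hfin]
    _ ≤ _ := measure_mono h2

noncomputable def MM (n : ℕ) (G : EuclideanSpace ℝ (Fin n) → ℝ≥0∞)
    (x : EuclideanSpace ℝ (Fin n)) : ℝ≥0∞ :=
  ⨆ r : {r : ℝ // 0 < r}, (volume (ball x r.1))⁻¹ * ∫⁻ y in ball x r.1, G y

lemma vol_ball_pos (n : ℕ) (x : EuclideanSpace ℝ (Fin n)) {r : ℝ} (hr : 0 < r) :
    volume (ball x r) ≠ 0 := (measure_ball_pos volume x hr).ne'

lemma vol_ball_fin (n : ℕ) (x : EuclideanSpace ℝ (Fin n)) (r : ℝ) :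
    volume (ball x r) ≠ ⊤ := measure_ball_lt_top.ne

lemma vol_ball_scale (n : ℕ) (x y : EuclideanSpace ℝ (Fin n)) {c r : ℝ} (hc : 0 < c) (hr : 0 < r) :
    volume (ball x (c * r)) = ENNReal.ofReal c ^ n * volume (ball y r) := by
  rw [Measure.addHaar_ball_of_pos _ _ (mul_pos hc hr), Measure.addHaar_ball_of_pos _ _ hr,
    finrank_euclideanSpace_fin, mul_pow, ENNReal.ofReal_mul (by positivity), mul_assoc,
    ENNReal.ofReal_pow hc.le]

lemma vol_cball_scale (n : ℕ) (x y : EuclideanSpace ℝ (Fin n)) {c r : ℝ} (hc : 0 < c) (hr : 0 < r) :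
    volume (closedBall x (c * r)) = ENNReal.ofReal c ^ n * volume (ball y r) := by
  rw [Measure.addHaar_closedBall _ _ (mul_pos hc hr).le, Measure.addHaar_ball_of_pos _ _ hr,
    finrank_euclideanSpace_fin, mul_pow, ENNReal.ofReal_mul (by positivity), mul_assoc,
    ENNReal.ofReal_pow hc.le]

lemma weak_R (n : ℕ) (G : EuclideanSpace ℝ (Fin n) → ℝ≥0∞) (l : ℝ≥0∞) (R : ℝ) :
    l * volume {x | ∃ r, 0 < r ∧ r ≤ R ∧ l * volume (ball x r) ≤ ∫⁻ y in ball x r, G y} ≤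
      5 ^ n * ∫⁻ y, G y := by
  set S := {x | ∃ r, 0 < r ∧ r ≤ R ∧ l * volume (ball x r) ≤ ∫⁻ y in ball x r, G y} with hS
  have hex : ∀ x : EuclideanSpace ℝ (Fin n), ∃ r, x ∈ S → 0 < r ∧ r ≤ R ∧ l * volume (ball x r) ≤ ∫⁻ y in ball x r, G y := by
    intro x
    by_cases hx : x ∈ S
    · obtain ⟨r, hr⟩ := hx
      exact ⟨r, fun _ => hr⟩
    · exact ⟨0, fun h => absurd h hx⟩
  choose r hr using hex
  obtain ⟨u, huS, hud, huc⟩ := Vitali.exists_disjoint_subfamily_covering_enlargement_closedBall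
    S (fun x => x) r R (fun a ha => (hr a ha).2.1) 5 (by norm_num)
  have hd : u.PairwiseDisjoint (fun a => ball a (r a)) := hud.mono fun a => ball_subset_closedBall
  have hcount : u.Countable := hd.countable_of_isOpen (fun _ _ => isOpen_ball)
    (fun a ha => nonempty_ball.2 (hr a (huS ha)).1)
  have hsub : S ⊆ ⋃ a ∈ u, closedBall a (5 * r a) := by
    intro x hx
    obtain ⟨b, hb, hxb⟩ := huc x hx
    exact mem_biUnion hb (hxb (mem_closedBall_self (hr x hx).1.le))
  calc l * volume S ≤ l * ∑' a : u, volume (closedBall a.1 (5 * r a.1)) := by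
        gcongr
        exact (measure_mono hsub).trans (measure_biUnion_le _ hcount _)
    _ = ∑' a : u, 5 ^ n * (l * volume (ball a.1 (r a.1))) := by
        rw [← ENNReal.tsum_mul_left]
        refine tsum_congr fun a => ?_
        rw [vol_cball_scale n a.1 a.1 (by norm_num) (hr a.1 (huS a.2)).1]
        rw [show ENNReal.ofReal 5 = 5 by norm_num]
        ring
    _ ≤ ∑' a : u, 5 ^ n * ∫⁻ y in ball a.1 (r a.1), G y := by
        refine ENNReal.tsum_le_tsum fun a => ?_
        gcongr
        exact (hr a.1 (huS a.2)).2.2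
    _ = 5 ^ n * ∫⁻ y in ⋃ a ∈ u, ball a (r a), G y := by
        rw [ENNReal.tsum_mul_left, lintegral_biUnion hcount (fun _ _ => measurableSet_ball) hd]
    _ ≤ _ := by
        gcongr
        exact Measure.restrict_le_self

lemma weak (n : ℕ) (G : EuclideanSpace ℝ (Fin n) → ℝ≥0∞) (l : ℝ≥0∞) :
    l * volume {x | l < MM n G x} ≤ 5 ^ n * ∫⁻ y, G y := by
  let S : ℕ → Set (EuclideanSpace ℝ (Fin n)) := fun k =>
    {x | ∃ r, 0 < r ∧ r ≤ (k:ℝ) ∧ l * volume (ball x r) ≤ ∫⁻ y in ball x r, G y}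
  have hmono : Monotone S := by
    rintro j k hjk x ⟨r, h0, h1, h2⟩
    exact ⟨r, h0, h1.trans (by exact_mod_cast hjk), h2⟩
  have hsub : {x | l < MM n G x} ⊆ ⋃ k, S k := by
    intro x hx
    have hx' : l < MM n G x := hx
    unfold MM at hx'
    obtain ⟨r, hr⟩ := lt_iSup_iff.1 hx'
    obtain ⟨k, hk⟩ := exists_nat_ge r.1
    refine mem_iUnion.2 ⟨k, r.1, r.2, hk, ?_⟩
    rw [mul_comm, ← div_eq_mul_inv, ENNReal.lt_div_iff_mul_lt (Or.inl (vol_ball_pos n x r.2))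
      (Or.inl (vol_ball_fin n x r.1))] at hr
    exact hr.le
  calc l * volume {x | l < MM n G x} ≤ l * volume (⋃ k, S k) := by gcongr
    _ = ⨆ k, l * volume (S k) := by rw [hmono.measure_iUnion, ENNReal.mul_iSup]
    _ ≤ _ := iSup_le fun k => weak_R n G l k

noncomputable def DD (h : ℝ → ℝ≥0∞) (t : ℝ) : ℝ≥0∞ :=
  ENNReal.ofReal (1 / t) * ∫⁻ s in Ioc (0:ℝ) t, h s

lemma rearr_le_DD (n : ℕ) (G : EuclideanSpace ℝ (Fin n) → ℝ≥0∞) {t : ℝ} (ht : 0 < t) :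
    rearr n G t ≤ DD (rearr n G) t := by
  unfold DD
  calc rearr n G t = ENNReal.ofReal (1/t) * ∫⁻ s in Ioc (0:ℝ) t, rearr n G t := by
        rw [setLIntegral_const, Real.volume_Ioc, sub_zero, mul_comm (rearr n G t), ← mul_assoc,
          ← ENNReal.ofReal_mul (by positivity)]
        rw [one_div_mul_cancel ht.ne']; simp
    _ ≤ _ := by
        refine mul_le_mul_right ?_ _
        refine setLIntegral_mono' measurableSet_Ioc fun s hs => ?_
        exact rearr_anti n G hs.2

lemma MM_split (n : ℕ) {G : EuclideanSpace ℝ (Fin n) → ℝ≥0∞} (hG : Measurable G) (c : ℝ≥0∞)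
    (x : EuclideanSpace ℝ (Fin n)) :
    MM n G x ≤ MM n ({y | c < G y}.indicator G) x + c := by
  refine iSup_le fun r => ?_
  have hE : MeasurableSet {y | c < G y} := measurableSet_lt measurable_const hG
  calc (volume (ball x r.1))⁻¹ * ∫⁻ y in ball x r.1, G y
      ≤ (volume (ball x r.1))⁻¹ * ∫⁻ y in ball x r.1, ({y | c < G y}.indicator G y + c) := by
        gcongr with y
        by_cases hy : c < G y
        · simp [indicator, hy]
        · simp [indicator, hy, not_lt.1 hy]
    _ = (volume (ball x r.1))⁻¹ * (∫⁻ y in ball x r.1, {y | c < G y}.indicator G y) + c := by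
        rw [lintegral_add_right _ measurable_const, mul_add, setLIntegral_const,
          mul_comm c, ← mul_assoc, ENNReal.inv_mul_cancel (vol_ball_pos n x r.2) (vol_ball_fin n x r.1), one_mul]
    _ ≤ _ := by
        gcongr
        exact le_iSup (fun r : {r : ℝ // 0 < r} => (volume (ball x r.1))⁻¹ * ∫⁻ y in ball x r.1, {y | c < G y}.indicator G y) r

lemma rearr_MM (n : ℕ) {G : EuclideanSpace ℝ (Fin n) → ℝ≥0∞} (hG : Measurable G) {t : ℝ} (ht : 0 < t) :
    rearr n (MM n G) t ≤ (5 ^ n + 1) * DD (rearr n G) t := by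
  have hK0 : (5 ^ n + 1 : ℝ≥0∞) ≠ 0 := by simp
  have hKt : (5 ^ n + 1 : ℝ≥0∞) ≠ ⊤ := by simp
  rw [← ENNReal.div_le_iff' hK0 hKt]
  refine le_of_forall_gt_imp_ge_of_dense fun c hc => ?_
  rw [ENNReal.div_le_iff' hK0 hKt]
  rcases eq_or_ne c ⊤ with rfl | hct
  · rw [ENNReal.mul_top hK0]; exact le_top
  have hc0 : c ≠ 0 := (pos_of_gt hc).ne'
  apply sInf_le
  have hvol : volume {x | c < G x} ≤ ENNReal.ofReal t :=
    vol_le_of_rearr_lt n G ((rearr_le_DD n G ht).trans_lt hc)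
  have hE : MeasurableSet {y | c < G y} := measurableSet_lt measurable_const hG
  have hIeq : ∫⁻ y, {y | c < G y}.indicator G y ≤ ENNReal.ofReal t * c := by
    rw [lintegral_indicator hE]
    refine (setL_le_rearr n hG hvol).trans ?_
    calc ∫⁻ s in Ioc (0:ℝ) t, rearr n G s = ENNReal.ofReal t * DD (rearr n G) t := by
          unfold DD
          rw [← mul_assoc, ← ENNReal.ofReal_mul ht.le, mul_one_div_cancel ht.ne']; simp
      _ ≤ _ := by gcongr
  have hsub : {x | (5 ^ n + 1) * c < MM n G x} ⊆ {x | 5 ^ n * c < MM n ({y | c < G y}.indicator G) x} := by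
    intro x hx
    have h1 : (5 ^ n + 1) * c < _ := lt_of_lt_of_le hx (MM_split n hG c x)
    rw [add_mul, one_mul] at h1
    exact lt_of_add_lt_add_right h1
  refine (measure_mono hsub).trans ?_
  have hw := (weak n ({y | c < G y}.indicator G) (5 ^ n * c)).trans (mul_le_mul_right hIeq (5^n))
  have h5 : (5 ^ n * c : ℝ≥0∞) ≠ 0 := by simp [hc0]
  have h5' : (5 ^ n * c : ℝ≥0∞) ≠ ⊤ := ENNReal.mul_ne_top (by simp) hct
  rw [← ENNReal.mul_le_mul_iff_right h5 h5']
  refine hw.trans (le_of_eq ?_)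
  ring

noncomputable def NN (p q : ℝ) (h : ℝ → ℝ≥0∞) : ℝ≥0∞ :=
  ∫⁻ t in Ioi (0:ℝ), (ENNReal.ofReal (t ^ (1 / p)) * h t) ^ q * ENNReal.ofReal (1 / t)

lemma jensen_w {α : Type*} [MeasurableSpace α] (μ : Measure α) {q : ℝ} (hq : 1 ≤ q) {w k : α → ℝ≥0∞}
    (hw : Measurable w) (hk : Measurable k) :
    (∫⁻ x, w x * k x ∂μ) ^ q ≤ (∫⁻ x, w x ∂μ) ^ (q - 1) * ∫⁻ x, w x * k x ^ q ∂μ := by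
  rcases hq.eq_or_lt with rfl | hq1
  · simp
  have hq0 : 0 < q := by linarith
  set q' := q.conjExponent with hq'
  have hc : q'.HolderConjugate q := (Real.HolderConjugate.conjExponent hq1).symm
  have hq'0 : 0 < q' := hc.pos
  have hsum : 1 / q' + 1 / q = 1 := by simpa using hc.inv_add_inv_eq_one
  have h := ENNReal.lintegral_mul_le_Lp_mul_Lq μ hc (f := fun x => w x ^ (1 / q'))
    (g := fun x => w x ^ (1 / q) * k x) (hw.pow_const _).aemeasurable
    ((hw.pow_const _).mul hk).aemeasurable
  have e1 : ∀ x, ((fun x => w x ^ (1 / q')) * (fun x => w x ^ (1 / q) * k x)) x = w x * k x := by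
    intro x
    simp only [Pi.mul_apply]
    rw [← mul_assoc, ← ENNReal.rpow_add_of_nonneg _ _ (by positivity) (by positivity), hsum, ENNReal.rpow_one]
  have e2 : ∀ x, (w x ^ (1 / q')) ^ q' = w x := by
    intro x
    rw [← ENNReal.rpow_mul, one_div_mul_cancel hq'0.ne', ENNReal.rpow_one]
  have e3 : ∀ x, (w x ^ (1 / q) * k x) ^ q = w x * k x ^ q := by
    intro x
    rw [ENNReal.mul_rpow_of_nonneg _ _ hq0.le, ← ENNReal.rpow_mul, one_div_mul_cancel hq0.ne', ENNReal.rpow_one]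
  simp only [e1, e2, e3] at h
  calc (∫⁻ x, w x * k x ∂μ) ^ q ≤ ((∫⁻ x, w x ∂μ) ^ (1 / q') * (∫⁻ x, w x * k x ^ q ∂μ) ^ (1 / q)) ^ q := by
        gcongr
    _ = _ := by
        rw [ENNReal.mul_rpow_of_nonneg _ _ hq0.le, ← ENNReal.rpow_mul, ← ENNReal.rpow_mul,
          one_div_mul_cancel hq0.ne', ENNReal.rpow_one]
        congr 2
        have : 1 / q' = 1 - 1 / q := by linarith
        rw [this]; field_simp

lemma lint_Ioc (r t : ℝ) (hr : -1 < r) (ht : 0 < t) :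
    ∫⁻ x in Ioc (0:ℝ) t, ENNReal.ofReal (x ^ r) = ENNReal.ofReal (t ^ (r + 1) / (r + 1)) := by
  have hi : IntegrableOn (fun x : ℝ => x ^ r) (Ioc 0 t) volume :=
    (intervalIntegrable_iff_integrableOn_Ioc_of_le ht.le).1 (intervalIntegral.intervalIntegrable_rpow' hr)
  rw [← ofReal_integral_eq_lintegral_ofReal hi]
  · rw [← intervalIntegral.integral_of_le ht.le, integral_rpow (Or.inl hr), Real.zero_rpow (by linarith), sub_zero]
  · filter_upwards [ae_restrict_mem measurableSet_Ioc] with x hx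
    exact Real.rpow_nonneg hx.1.le _

lemma lint_Ioi (r c : ℝ) (hr : r < -1) (hc : 0 < c) :
    ∫⁻ x in Ioi c, ENNReal.ofReal (x ^ r) = ENNReal.ofReal (-c ^ (r + 1) / (r + 1)) := by
  rw [← ofReal_integral_eq_lintegral_ofReal (integrableOn_Ioi_rpow_of_lt hr hc)]
  · rw [integral_Ioi_rpow_of_lt hr hc]
  · filter_upwards [ae_restrict_mem measurableSet_Ioi] with x hx
    exact Real.rpow_nonneg (hc.trans hx).le _

lemma tonelli_tri {u F : ℝ → ℝ≥0∞} (hu : Measurable u) (hF : Measurable F) :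
    ∫⁻ t in Ioi (0:ℝ), u t * ∫⁻ s in Ioc (0:ℝ) t, F s =
      ∫⁻ s in Ioi (0:ℝ), F s * ∫⁻ t in Ioi s, u t := by
  let K : ℝ → ℝ → ℝ≥0∞ := fun t s => {z : ℝ × ℝ | z.2 ≤ z.1}.indicator (fun z => u z.1 * F z.2) (t, s)
  have hK : Measurable (Function.uncurry K) := by
    have : Function.uncurry K = {z : ℝ × ℝ | z.2 ≤ z.1}.indicator (fun z => u z.1 * F z.2) := by
      ext ⟨a, b⟩; rfl
    rw [this]
    exact ((hu.comp measurable_fst).mul (hF.comp measurable_snd)).indicator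
      (measurableSet_le measurable_snd measurable_fst)
  have h1 : ∀ t : ℝ, u t * ∫⁻ s in Ioc (0:ℝ) t, F s = ∫⁻ s in Ioi (0:ℝ), K t s := by
    intro t
    have : ∀ s, K t s = (Iic t).indicator (fun s => u t * F s) s := by
      intro s; simp only [K, indicator]; rfl
    simp only [this]
    rw [lintegral_indicator measurableSet_Iic, Measure.restrict_restrict measurableSet_Iic,
      inter_comm, Ioi_inter_Iic, lintegral_const_mul _ hF]
  have h2 : ∀ s ∈ Ioi (0:ℝ), F s * ∫⁻ t in Ioi s, u t = ∫⁻ t in Ioi (0:ℝ), K t s := by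
    intro s hs
    have : ∀ t, K t s = (Ici s).indicator (fun t => F s * u t) t := by
      intro t; simp only [K, indicator, mul_comm (F s)]; rfl
    simp only [this]
    have hsub : Ici s ∩ Ioi (0:ℝ) = Ici s := by
      refine inter_eq_left.2 ?_
      intro t ht
      exact lt_of_lt_of_le (mem_Ioi.1 hs) (mem_Ici.1 ht)
    rw [lintegral_indicator measurableSet_Ici, Measure.restrict_restrict measurableSet_Ici,
      hsub, lintegral_const_mul _ hu,
      setLIntegral_congr Ioi_ae_eq_Ici]
  rw [setLIntegral_congr_fun measurableSet_Ioi h2, ← lintegral_lintegral_swap hK.aemeasurable]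
  simp only [h1]

lemma hardy (p q : ℝ) (hp : 1 < p) (hq : 1 ≤ q) {h : ℝ → ℝ≥0∞} (hh : Measurable h) :
    NN p q (DD h) ≤ ENNReal.ofReal ((1 / (1 - 1 / p)) ^ q) * NN p q h := by
  set a := 1 / p with ha
  have ha0 : 0 < a := by positivity
  have ha1 : a < 1 := by rw [ha, div_lt_one (by linarith)]; exact hp
  set P := 1 / (1 - a) with hP
  have hP0 : 0 < P := by rw [hP]; apply one_div_pos.2; linarith
  have hq0 : 0 < q := by linarith
  let F : ℝ → ℝ≥0∞ := fun s => ENNReal.ofReal (s ^ (-a)) * (ENNReal.ofReal (s ^ a) * h s) ^ q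
  have hF : Measurable F := by fun_prop
  let u : ℝ → ℝ≥0∞ := fun t => ENNReal.ofReal (t ^ (a - 2))
  have hu : Measurable u := by fun_prop
  have step1 : ∀ t ∈ Ioi (0:ℝ), (ENNReal.ofReal (t ^ a) * DD h t) ^ q * ENNReal.ofReal (1 / t) ≤
      ENNReal.ofReal (P ^ (q - 1)) * (u t * ∫⁻ s in Ioc (0:ℝ) t, F s) := by
    intro t ht
    have ht : 0 < t := ht
    have hj := jensen_w (volume.restrict (Ioc (0:ℝ) t)) hq (w := fun s => ENNReal.ofReal (s ^ (-a)))
      (k := fun s => ENNReal.ofReal (s ^ a) * h s) (by fun_prop) (by fun_prop)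
    have e : ∫⁻ s in Ioc (0:ℝ) t, ENNReal.ofReal (s ^ (-a)) * (ENNReal.ofReal (s ^ a) * h s) =
        ∫⁻ s in Ioc (0:ℝ) t, h s := by
      refine setLIntegral_congr_fun measurableSet_Ioc fun s hs => ?_
      have hs0 : 0 < s := hs.1
      rw [← mul_assoc, ← ENNReal.ofReal_mul (by positivity), ← Real.rpow_add hs0]
      simp
    rw [e, lint_Ioc (-a) t (by linarith) ht] at hj
    unfold DD
    rw [← mul_assoc, ← ENNReal.ofReal_mul (by positivity), ENNReal.mul_rpow_of_nonneg _ _ hq0.le,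
      ENNReal.ofReal_rpow_of_pos (by positivity)]
    refine (mul_le_mul_left (mul_le_mul_right hj _) _).trans (le_of_eq ?_)
    have h1a : 0 < 1 - a := by linarith
    have e3 : t ^ (-a + 1) / (-a + 1) = t ^ (1 - a) * P := by
      rw [hP, show -a + 1 = 1 - a by ring]; ring
    rw [e3, ENNReal.ofReal_rpow_of_pos (by positivity)]
    have e2 : (t ^ a * (1 / t)) ^ q * (t ^ (1 - a) * P) ^ (q - 1) * (1 / t) = P ^ (q - 1) * t ^ (a - 2) := by
      rw [Real.mul_rpow (by positivity) hP0.le, ← Real.rpow_mul ht.le]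
      rw [show t ^ a * (1 / t) = t ^ (a - 1) by rw [Real.rpow_sub_one ht.ne']; ring]
      rw [← Real.rpow_mul ht.le, show 1 / t = t ^ (-1 : ℝ) by rw [Real.rpow_neg_one]; simp]
      rw [show a - 2 = (a - 1) * q + (1 - a) * (q - 1) + (-1) by ring, Real.rpow_add ht, Real.rpow_add ht]
      ring
    simp only [F, u]
    rw [← mul_assoc (ENNReal.ofReal (P ^ (q-1))), ← ENNReal.ofReal_mul (by positivity), ← e2,
      ENNReal.ofReal_mul (by positivity), ENNReal.ofReal_mul (by positivity)]
    ring
  have step2 : ∀ s ∈ Ioi (0:ℝ), F s * ∫⁻ t in Ioi s, u t =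
      ENNReal.ofReal P * ((ENNReal.ofReal (s ^ a) * h s) ^ q * ENNReal.ofReal (1 / s)) := by
    intro s hs
    have hs : 0 < s := hs
    simp only [F, u]
    have e3 : -s ^ (a - 2 + 1) / (a - 2 + 1) = P * s ^ (a - 1) := by
      rw [hP, show a - 2 + 1 = a - 1 by ring]
      rw [neg_div, ← div_neg, neg_sub]; ring
    rw [lint_Ioi _ _ (by linarith) hs, e3, show 1 / s = s ^ (-a) * s ^ (a - 1) by
      rw [← Real.rpow_add hs, show -a + (a - 1) = -1 by ring, Real.rpow_neg_one]; simp]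
    rw [ENNReal.ofReal_mul (by positivity), ENNReal.ofReal_mul (by positivity)]
    ring
  unfold NN
  calc _ ≤ ∫⁻ t in Ioi (0:ℝ), ENNReal.ofReal (P ^ (q - 1)) * (u t * ∫⁻ s in Ioc (0:ℝ) t, F s) :=
        setLIntegral_mono' measurableSet_Ioi step1
    _ = ENNReal.ofReal (P ^ (q - 1)) * ∫⁻ t in Ioi (0:ℝ), (u t * ∫⁻ s in Ioc (0:ℝ) t, F s) := by
        rw [lintegral_const_mul' _ _ ENNReal.ofReal_ne_top]
    _ = _ := by
        rw [tonelli_tri hu hF, setLIntegral_congr_fun measurableSet_Ioi step2,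
          lintegral_const_mul' _ _ ENNReal.ofReal_ne_top, ← mul_assoc, ← ENNReal.ofReal_mul (by positivity)]
        congr 2
        rw [Real.rpow_sub_one hP0.ne']; field_simp

lemma NN_mono (p q : ℝ) (hq : 0 ≤ q) {h k : ℝ → ℝ≥0∞} (hk : ∀ t, 0 < t → h t ≤ k t) : NN p q h ≤ NN p q k := by
  refine setLIntegral_mono' measurableSet_Ioi fun t ht => ?_
  have := hk t ht
  gcongr

lemma NN_const_mul (p q : ℝ) (hq : 0 ≤ q) {h : ℝ → ℝ≥0∞} {c : ℝ≥0∞} (hc : c ≠ ⊤) :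
    NN p q (fun t => c * h t) = c ^ q * NN p q h := by
  unfold NN
  rw [← lintegral_const_mul' _ _ (ENNReal.rpow_ne_top_of_nonneg hq hc)]
  refine lintegral_congr fun t => ?_
  rw [← mul_assoc (c ^ q), ← ENNReal.mul_rpow_of_nonneg _ _ hq]
  congr 2; ring

lemma NN_MM (n : ℕ) (p q : ℝ) (hp : 1 < p) (hq : 1 ≤ q) : ∃ A : ℝ≥0∞, A ≠ ⊤ ∧
    ∀ G : EuclideanSpace ℝ (Fin n) → ℝ≥0∞, Measurable G →
      NN p q (rearr n (MM n G)) ≤ A * NN p q (rearr n G) := by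
  refine ⟨(5 ^ n + 1) ^ q * ENNReal.ofReal ((1 / (1 - 1 / p)) ^ q), ?_, fun G hG => ?_⟩
  · exact ENNReal.mul_ne_top (ENNReal.rpow_ne_top_of_nonneg (by linarith) (by simp)) ENNReal.ofReal_ne_top
  · calc _ ≤ NN p q (fun t => (5 ^ n + 1) * DD (rearr n G) t) :=
          NN_mono p q (by linarith) fun t ht => rearr_MM n hG ht
      _ = _ := NN_const_mul p q (by linarith) (by simp)
      _ ≤ _ := by
          rw [mul_assoc]
          exact mul_le_mul_right (hardy p q hp hq (measurable_rearr n G)) _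

lemma rearr_const (n : ℕ) (B : Set (EuclideanSpace ℝ (Fin n))) (K : ℝ≥0∞) (t : ℝ) :
    rearr n (B.indicator fun _ => K) t = if ENNReal.ofReal t < volume B then K else 0 := by
  unfold rearr
  split_ifs with h
  · apply le_antisymm
    · apply sInf_le
      have : {x | K < B.indicator (fun _ => K) x} = ∅ := by
        ext x
        simp only [mem_ofPred_eq, mem_empty_iff_false, iff_false, not_lt]
        exact indicator_le_self' (by simp) x
      change volume {x | K < B.indicator (fun _ => K) x} ≤ _
      rw [this]; simp
    · refine le_sInf fun l hl => ?_
      by_contra hcon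
      push Not at hcon
      have hsub : B ⊆ {x | l < B.indicator (fun _ => K) x} := by
        intro x hx
        simp [hx, hcon]
      exact absurd ((measure_mono hsub).trans hl) (not_le.2 h)
  · apply le_antisymm _ (zero_le)
    apply sInf_le
    have hsub : {x | 0 < B.indicator (fun _ => K) x} ⊆ B := by
      intro x hx
      by_contra hxB
      simp [hxB] at hx
    exact (measure_mono hsub).trans (not_lt.1 h)

lemma rearr_max (n : ℕ) (B : Set (EuclideanSpace ℝ (Fin n))) (K : ℝ≥0∞) (t : ℝ)
    (F H : EuclideanSpace ℝ (Fin n) → ℝ≥0∞) (hF : ∀ x ∈ B, F x ≤ max (H x) K) :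
    rearr n (B.indicator F) t ≤ max (rearr n H t) (rearr n (B.indicator fun _ => K) t) := by
  rw [rearr_const]
  split_ifs with h
  · refine le_of_forall_gt_imp_ge_of_dense fun c hc => ?_
    obtain ⟨h1, h2⟩ := max_lt_iff.1 hc
    apply sInf_le
    refine (measure_mono ?_).trans (vol_le_of_rearr_lt n H h1)
    intro x hx
    have hx : c < B.indicator F x := hx
    change c < H x
    by_cases hxB : x ∈ B
    · rw [indicator_of_mem hxB] at hx
      rcases lt_max_iff.1 (hx.trans_le (hF x hxB)) with h3 | h3
      · exact h3
      · exact absurd h3 (not_lt.2 h2.le)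
    · simp [hxB] at hx
  · refine le_trans ?_ (zero_le)
    apply sInf_le
    have hsub : {x | 0 < B.indicator F x} ⊆ B := by
      intro x hx
      by_contra hxB
      simp [hxB] at hx
    exact (measure_mono hsub).trans (not_lt.1 h)

lemma NN_max (p q : ℝ) (hq : 0 ≤ q) {h k : ℝ → ℝ≥0∞} (hh : Measurable h) :
    NN p q (fun t => max (h t) (k t)) ≤ NN p q h + NN p q k := by
  unfold NN
  rw [← lintegral_add_left (by fun_prop)]
  refine lintegral_mono fun t => ?_
  rcases max_cases (h t) (k t) with ⟨h1, _⟩ | ⟨h1, _⟩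
  · simp only [h1]; exact le_self_add
  · simp only [h1]; exact le_add_self

lemma NN_const (n : ℕ) (p q : ℝ) (hp : 1 < p) (hq : 1 ≤ q) : ∃ D : ℝ, 0 < D ∧
    ∀ (x : EuclideanSpace ℝ (Fin n)) (r : ℝ) (K : ℝ≥0∞), 0 < r →
      NN p q (rearr n ((ball x r).indicator fun _ => K)) =
        K ^ q * ENNReal.ofReal (D * r ^ (n * q / p)) := by
  have hp0 : 0 < p := by linarith
  have hq0 : 0 < q := by linarith
  set ω := (volume (ball (0 : EuclideanSpace ℝ (Fin n)) 1)).toReal with hω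
  have hω0 : 0 < ω := ENNReal.toReal_pos (vol_ball_pos n 0 one_pos) (vol_ball_fin n 0 1)
  refine ⟨ω ^ (q / p) / (q / p), by positivity, fun x r K hr => ?_⟩
  have hv : volume (ball x r) = ENNReal.ofReal (r ^ n * ω) := by
    rw [Measure.addHaar_ball_of_pos _ _ hr, finrank_euclideanSpace_fin, ENNReal.ofReal_mul (by positivity),
      hω, ENNReal.ofReal_toReal (vol_ball_fin n 0 1)]
  set v := r ^ n * ω with hvdef
  have hv0 : 0 < v := by positivity
  unfold NN
  have e : ∀ t ∈ Ioi (0:ℝ), (ENNReal.ofReal (t ^ (1 / p)) * rearr n ((ball x r).indicator fun _ => K) t) ^ q *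
      ENNReal.ofReal (1 / t) = (Iio v).indicator (fun t => K ^ q * ENNReal.ofReal (t ^ (q / p - 1))) t := by
    intro t ht
    have ht : 0 < t := ht
    rw [rearr_const, hv]
    by_cases htv : t < v
    · rw [if_pos ((ENNReal.ofReal_lt_ofReal_iff hv0).2 htv), indicator_of_mem (show t ∈ Iio v from htv),
        ENNReal.mul_rpow_of_nonneg _ _ hq0.le, ENNReal.ofReal_rpow_of_pos (by positivity),
        ← Real.rpow_mul ht.le, Real.rpow_sub_one ht.ne', show t ^ (q / p) / t = t ^ (1 / p * q) * (1 / t) by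
          rw [one_div_mul_eq_div]; ring, ENNReal.ofReal_mul (by positivity)]
      ring
    · rw [if_neg (fun h => htv ((ENNReal.ofReal_lt_ofReal_iff hv0).1 h)),
        indicator_of_notMem (show t ∉ Iio v from htv)]
      simp [hq0]
  rw [setLIntegral_congr_fun measurableSet_Ioi e, lintegral_indicator measurableSet_Iio,
    Measure.restrict_restrict measurableSet_Iio, inter_comm, Ioi_inter_Iio,
    lintegral_const_mul _ (by fun_prop), setLIntegral_congr Ioo_ae_eq_Ioc,
    lint_Ioc _ _ (by linarith [show 0 < q / p by positivity]) hv0]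
  congr 2
  rw [sub_add_cancel, hvdef, Real.mul_rpow (by positivity) hω0.le, ← Real.rpow_natCast, ← Real.rpow_mul hr.le,
    mul_div_assoc (n:ℝ)]
  ring

lemma MM_lower (n : ℕ) (G : EuclideanSpace ℝ (Fin n) → ℝ≥0∞) (x z : EuclideanSpace ℝ (Fin n)) {R : ℝ}
    (hR : 0 < R) (hz : z ∈ ball x R) :
    (volume (ball x (2 * R)))⁻¹ * ∫⁻ y in ball x R, G y ≤ MM n ((ball x R).indicator G) z := by
  refine le_trans ?_ (le_iSup (fun r : {r : ℝ // 0 < r} => (volume (ball z r.1))⁻¹ *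
    ∫⁻ y in ball z r.1, (ball x R).indicator G y) ⟨2 * R, by positivity⟩)
  dsimp only
  rw [vol_ball_scale n x z two_pos hR, vol_ball_scale n z z two_pos hR, setLIntegral_indicator measurableSet_ball]
  rw [inter_eq_left.2]
  intro y hy
  rw [mem_ball] at *
  calc dist y z ≤ dist y x + dist z x := dist_triangle_right _ _ _
    _ < 2 * R := by linarith

lemma MM_upper (n : ℕ) (G : EuclideanSpace ℝ (Fin n) → ℝ≥0∞) (x y : EuclideanSpace ℝ (Fin n)) {r : ℝ}
    (hy : y ∈ ball x r) (K : ℝ≥0∞)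
    (hK : ∀ ρ, r ≤ ρ → (volume (ball x ρ))⁻¹ * ∫⁻ z in ball x (2 * ρ), G z ≤ K) :
    MM n G y ≤ max (MM n ((ball x (2 * r)).indicator G) y) K := by
  rw [mem_ball] at hy
  have hr : 0 < r := dist_nonneg.trans_lt hy
  refine iSup_le fun ρ => ?_
  rcases lt_or_ge ρ.1 r with h | h
  · refine le_trans ?_ (le_max_left _ _)
    refine le_trans ?_ (le_iSup (fun r' : {r : ℝ // 0 < r} => (volume (ball y r'.1))⁻¹ *
      ∫⁻ z in ball y r'.1, (ball x (2 * r)).indicator G z) ρ)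
    rw [setLIntegral_indicator measurableSet_ball, inter_eq_right.2]
    intro z hz
    rw [mem_ball] at *
    linarith [dist_triangle z y x]
  · refine le_trans ?_ (le_max_right _ _)
    refine le_trans ?_ (hK ρ.1 h)
    have hv : volume (ball y ρ.1) = volume (ball x ρ.1) := by
      have := vol_ball_scale n y x one_pos ρ.2
      simpa using this
    rw [hv]
    refine mul_le_mul_right (lintegral_mono_set ?_) _
    intro z hz
    rw [mem_ball] at *
    linarith [dist_triangle z y x]

lemma main_bound (n : ℕ) (p q lam : ℝ) (hp : 1 < p) (hq : 1 ≤ q) (hl0 : 0 ≤ lam) (hln : lam ≤ n) :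
    ∃ A : ℝ≥0∞, A ≠ ⊤ ∧ ∀ (G : EuclideanSpace ℝ (Fin n) → ℝ≥0∞) (X : ℝ≥0∞), Measurable G →
      (∀ x r, 0 < r → NN p q (rearr n ((ball x r).indicator G)) ≤ ENNReal.ofReal (r ^ (lam * q / p)) * X) →
      ∀ x r, 0 < r → NN p q (rearr n ((ball x r).indicator (MM n G))) ≤
        A * (ENNReal.ofReal (r ^ (lam * q / p)) * X) := by
  have hp0 : 0 < p := by linarith
  have hq0 : 0 < q := by linarith
  obtain ⟨A, hA, hMM⟩ := NN_MM n p q hp hq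
  obtain ⟨D, hD, hconst⟩ := NN_const n p q hp hq
  set k := lam * q / p with hk
  set m := (n : ℝ) * q / p with hm
  have hk0 : 0 ≤ k := by positivity
  have hkm : k ≤ m := by rw [hk, hm]; gcongr
  refine ⟨A * ENNReal.ofReal (2 ^ k) + (4 ^ n) ^ q * A, ?_, ?_⟩
  · refine ENNReal.add_ne_top.2 ⟨ENNReal.mul_ne_top hA ENNReal.ofReal_ne_top, ENNReal.mul_ne_top ?_ hA⟩
    exact ENNReal.rpow_ne_top_of_nonneg hq0.le (by simp)
  intro G X hG hX x r hr
  set Z := A * (ENNReal.ofReal (r ^ k) * X) with hZ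
  set c := ENNReal.ofReal (D * r ^ m) with hc
  have hc0 : c ≠ 0 := by rw [hc]; simp only [ne_eq, ENNReal.ofReal_eq_zero, not_le]; positivity
  have hct : c ≠ ⊤ := ENNReal.ofReal_ne_top
  set K' := (Z / c) ^ (1 / q) with hK'
  have hK'q : K' ^ q * c = Z := by
    rw [hK', ← ENNReal.rpow_mul, one_div_mul_cancel hq0.ne', ENNReal.rpow_one, ENNReal.div_mul_cancel hc0 hct]
  have hb : ∀ R, r ≤ R → (volume (ball x (2 * R)))⁻¹ * ∫⁻ y in ball x R, G y ≤ K' := by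
    intro R hrR
    have hR : 0 < R := hr.trans_le hrR
    set b := (volume (ball x (2 * R)))⁻¹ * ∫⁻ y in ball x R, G y with hbdef
    have h1 : b ^ q * ENNReal.ofReal (D * R ^ m) ≤ A * (ENNReal.ofReal (R ^ k) * X) := by
      rw [← hconst x R b hR]
      calc _ ≤ NN p q (rearr n (MM n ((ball x R).indicator G))) := by
            refine NN_mono p q hq0.le fun t _ => rearr_mono' n (fun z => ?_) t
            by_cases hz : z ∈ ball x R
            · rw [indicator_of_mem hz]; exact MM_lower n G x z hR hz
            · rw [indicator_of_notMem hz]; exact zero_le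
        _ ≤ A * NN p q (rearr n ((ball x R).indicator G)) := hMM _ (hG.indicator measurableSet_ball)
        _ ≤ _ := mul_le_mul_right (hX x R hR) _
    have hrR0 : 0 < r / R := by positivity
    have h2 : b ^ q * c ≤ Z := by
      calc b ^ q * c = ENNReal.ofReal ((r / R) ^ m) * (b ^ q * ENNReal.ofReal (D * R ^ m)) := by
            rw [hc, mul_left_comm, ← ENNReal.ofReal_mul (by positivity)]
            congr 2
            rw [Real.div_rpow hr.le hR.le]
            have : R ^ m ≠ 0 := by positivity
            field_simp
        _ ≤ ENNReal.ofReal ((r / R) ^ m) * (A * (ENNReal.ofReal (R ^ k) * X)) := mul_le_mul_right h1 _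
        _ = A * (ENNReal.ofReal ((r / R) ^ m * R ^ k) * X) := by
            rw [ENNReal.ofReal_mul (by positivity)]; ring
        _ ≤ A * (ENNReal.ofReal (r ^ k) * X) := by
            gcongr
            calc (r / R) ^ m * R ^ k ≤ (r / R) ^ k * R ^ k := by
                  exact mul_le_mul_of_nonneg_right
                    (Real.rpow_le_rpow_of_exponent_ge hrR0 ((div_le_one hR).2 hrR) hkm) (by positivity)
              _ = r ^ k := by rw [← Real.mul_rpow hrR0.le hR.le, div_mul_cancel₀ _ hR.ne']
    have h3 : b ^ q ≤ Z / c := (ENNReal.le_div_iff_mul_le (Or.inl hc0) (Or.inl hct)).2 h2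
    rw [hK']
    calc b = (b ^ q) ^ (1 / q) := by rw [← ENNReal.rpow_mul, mul_one_div_cancel hq0.ne', ENNReal.rpow_one]
      _ ≤ _ := ENNReal.rpow_le_rpow h3 (by positivity)
  have hK : ∀ ρ, r ≤ ρ → (volume (ball x ρ))⁻¹ * ∫⁻ z in ball x (2 * ρ), G z ≤ 4 ^ n * K' := by
    intro ρ hρ
    have hρ0 : 0 < ρ := hr.trans_le hρ
    refine le_trans (le_of_eq ?_) (mul_le_mul_right (hb (2 * ρ) (by linarith)) (4 ^ n))
    rw [show 2 * (2 * ρ) = 4 * ρ by ring, vol_ball_scale n x x (by norm_num : (0:ℝ) < 4) hρ0,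
      show ENNReal.ofReal 4 = 4 by norm_num, ENNReal.mul_inv (by simp) (by simp), ← mul_assoc, ← mul_assoc,
      ENNReal.mul_inv_cancel (by simp) (by simp), one_mul]
  calc NN p q (rearr n ((ball x r).indicator (MM n G)))
      ≤ NN p q (fun t => max (rearr n (MM n ((ball x (2 * r)).indicator G)) t)
          (rearr n ((ball x r).indicator fun _ => 4 ^ n * K') t)) :=
        NN_mono p q hq0.le fun t _ => rearr_max n _ _ t _ _ fun y hy => MM_upper n G x y hy _ hK
    _ ≤ NN p q (rearr n (MM n ((ball x (2 * r)).indicator G))) +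
          NN p q (rearr n ((ball x r).indicator fun _ => 4 ^ n * K')) :=
        NN_max p q hq0.le (measurable_rearr n _)
    _ ≤ A * (ENNReal.ofReal ((2 * r) ^ k) * X) + (4 ^ n) ^ q * Z := by
        refine add_le_add ?_ (le_of_eq ?_)
        · exact (hMM _ (hG.indicator measurableSet_ball)).trans (mul_le_mul_right (hX x (2 * r) (by positivity)) _)
        · rw [hconst x r _ hr, ENNReal.mul_rpow_of_nonneg _ _ hq0.le, mul_assoc, hK'q]
    _ = _ := by
        rw [Real.mul_rpow (by norm_num) hr.le, ENNReal.ofReal_mul (by positivity), hZ]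
        ring

lemma lorentzNorm_eq (n : ℕ) (p q : ℝ) (hq : 1 ≤ q) (g : EuclideanSpace ℝ (Fin n) → ℝ≥0∞) :
    lorentzNorm n p (ENNReal.ofReal q) g = NN p q (rearr n g) ^ (1 / q) := by
  unfold lorentzNorm NN
  rw [if_neg ENNReal.ofReal_ne_top, ENNReal.toReal_ofReal (by linarith)]

/-- for `1 < p < ∞`, `1 ≤ q < ∞`, `0 ≤ λ ≤ n`, the Hardy–Littlewood maximal
operator `M = M_0` is bounded on the Lorentz–Morrey space `𝓛_{p,q;λ}(ℝⁿ)`. -/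
theorem stmt_7 (n : ℕ) (p q lam : ℝ) (hp : 1 < p) (hq : 1 ≤ q)
    (hl0 : 0 ≤ lam) (hln : lam ≤ n) :
    ∃ C : ℝ, 0 < C ∧ ∀ f : EuclideanSpace ℝ (Fin n) → ℝ,
      lorentzMorrey n p (ENNReal.ofReal q) lam (fun x => ENNReal.ofReal |f x|) < ⊤ →
      lorentzMorrey n p (ENNReal.ofReal q) lam (fracMax n 0 f) ≤
        ENNReal.ofReal C * lorentzMorrey n p (ENNReal.ofReal q) lam
          (fun x => ENNReal.ofReal |f x|) := by
  have hp0 : 0 < p := by linarith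
  have hq0 : 0 < q := by linarith
  obtain ⟨A, hA, hmain⟩ := main_bound n p q lam hp hq hl0 hln
  have hAq : A ^ (1 / q) ≠ ⊤ := ENNReal.rpow_ne_top_of_nonneg (by positivity) hA
  refine ⟨(A ^ (1 / q)).toReal + 1, by positivity, fun f _ => ?_⟩
  obtain ⟨G, hG, hGf, hIeq⟩ := exists_measurable_le_forall_setLIntegral_eq
    (volume : Measure (EuclideanSpace ℝ (Fin n))) (fun x => ENNReal.ofReal |f x|)
  have hM : fracMax n 0 f = MM n G := by
    ext x
    unfold fracMax MM
    simp only [hIeq, zero_div, zero_sub, ENNReal.rpow_neg_one]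
  set N := lorentzMorrey n p (ENNReal.ofReal q) lam (fun x => ENNReal.ofReal |f x|) with hN
  have hrr : ∀ r : ℝ, 0 < r → ENNReal.ofReal (r ^ (lam * q / p)) = ENNReal.ofReal (r ^ (lam / p)) ^ q := by
    intro r hr
    rw [ENNReal.ofReal_rpow_of_pos (by positivity), ← Real.rpow_mul hr.le, div_mul_eq_mul_div]
  have hcan : ∀ r : ℝ, 0 < r → ENNReal.ofReal (r ^ (lam / p)) * ENNReal.ofReal (r ^ (-(lam / p))) = 1 := by
    intro r hr
    rw [← ENNReal.ofReal_mul (by positivity), ← Real.rpow_add hr]; simp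
  have hX : ∀ x r, 0 < r → NN p q (rearr n ((ball x r).indicator G)) ≤
      ENNReal.ofReal (r ^ (lam * q / p)) * N ^ q := by
    intro x r hr
    have h1 : ENNReal.ofReal (r ^ (-(lam / p))) *
        lorentzNorm n p (ENNReal.ofReal q) ((ball x r).indicator fun x => ENNReal.ofReal |f x|) ≤ N :=
      le_iSup₂ (f := fun (x : EuclideanSpace ℝ (Fin n)) (r : {r : ℝ // 0 < r}) =>
        ENNReal.ofReal (r.1 ^ (-(lam / p))) * lorentzNorm n p (ENNReal.ofReal q)
          ((ball x r.1).indicator fun x => ENNReal.ofReal |f x|)) x ⟨r, hr⟩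
    rw [lorentzNorm_eq n p q hq] at h1
    have h2 : NN p q (rearr n ((ball x r).indicator G)) ≤
        NN p q (rearr n ((ball x r).indicator fun x => ENNReal.ofReal |f x|)) :=
      NN_mono p q hq0.le fun t _ => rearr_mono' n (fun z => indicator_le_indicator (hGf z)) t
    refine h2.trans ?_
    set Y := NN p q (rearr n ((ball x r).indicator fun x => ENNReal.ofReal |f x|))
    rw [hrr r hr, ← ENNReal.mul_rpow_of_nonneg _ _ hq0.le]
    calc Y = (Y ^ (1 / q)) ^ q := by rw [← ENNReal.rpow_mul, one_div_mul_cancel hq0.ne', ENNReal.rpow_one]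
      _ = (ENNReal.ofReal (r ^ (lam / p)) * (ENNReal.ofReal (r ^ (-(lam / p))) * Y ^ (1 / q))) ^ q := by
          rw [← mul_assoc, hcan r hr, one_mul]
      _ ≤ _ := by gcongr
  have hres := hmain G (N ^ q) hG hX
  rw [hM]
  have hC : A ^ (1 / q) ≤ ENNReal.ofReal ((A ^ (1 / q)).toReal + 1) := by
    rw [← ENNReal.ofReal_toReal hAq]
    exact ENNReal.ofReal_le_ofReal (by simp)
  refine iSup₂_le fun x r => ?_
  rw [lorentzNorm_eq n p q hq]
  refine le_trans ?_ (mul_le_mul_left hC N)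
  calc _ ≤ ENNReal.ofReal (r.1 ^ (-(lam / p))) * (A * (ENNReal.ofReal (r.1 ^ (lam * q / p)) * N ^ q)) ^ (1 / q) :=
        mul_le_mul_right (ENNReal.rpow_le_rpow (hres x r.1 r.2) (by positivity)) _
    _ = ENNReal.ofReal (r.1 ^ (-(lam / p))) * (A ^ (1 / q) * (ENNReal.ofReal (r.1 ^ (lam / p)) * N)) := by
        rw [hrr r.1 r.2, ← ENNReal.mul_rpow_of_nonneg _ _ hq0.le, ENNReal.mul_rpow_of_nonneg _ _ (by positivity),
          ← ENNReal.rpow_mul, mul_one_div_cancel hq0.ne', ENNReal.rpow_one]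
    _ = A ^ (1 / q) * ((ENNReal.ofReal (r.1 ^ (lam / p)) * ENNReal.ofReal (r.1 ^ (-(lam / p)))) * N) := by ring
    _ ≤ _ := by rw [hcan r.1 r.2, one_mul]
end
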